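/- Let (b_n)_{n≥1} be a sequence of positive real numbers such that ∑_{n=1}^∞ b_n converges and b_k ≤ ∑_{n=k+1}^∞ b_n for every k ∈ ℤ⁺. Then for every real number s with −∑_{n=1}^∞ b_n ≤ s ≤ ∑_{n=1}^∞ b_n, there exists a sign function f : ℤ⁺ → {−1,1} such that ∑_{n=1}^∞ f(n)·b_n = s. -/

import Mathlib

open Filter

/-- The sign of `x`, with the convention that zero has sign `1`. -/
noncomputable def signOrOne (x : ℝ) : ℝ := if 0 ≤ x then 1 else -1

/-- What remains of `s` after greedily subtracting `± b i` for `i < n`, each time with the sign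
of the current remainder. -/
noncomputable def greedyRemainder (b : ℕ → ℝ) (s : ℝ) : ℕ → ℝ
  | 0 => s
  | n + 1 => greedyRemainder b s n - signOrOne (greedyRemainder b s n) * b n

lemma signOrOne_eq_neg_one_or_one (x : ℝ) : signOrOne x = -1 ∨ signOrOne x = 1 := by
  unfold signOrOne
  split_ifs <;> simp

lemma abs_sub_signOrOne_mul_le {x c t : ℝ} (hct : c ≤ t) (hx : |x| ≤ c + t) :
    |x - signOrOne x * c| ≤ t := by
  rw [abs_le] at hx ⊢
  unfold signOrOne
  split_ifs <;> constructor <;> linarith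

lemma sum_range_signOrOne_greedyRemainder (b : ℕ → ℝ) (s : ℝ) (n : ℕ) :
    ∑ i ∈ Finset.range n, signOrOne (greedyRemainder b s i) * b i =
      s - greedyRemainder b s n := by
  induction n with
  | zero => simp [greedyRemainder]
  | succ n ih =>
    rw [Finset.sum_range_succ, ih, greedyRemainder]
    ring

lemma abs_greedyRemainder_le {b : ℕ → ℝ} (hsum : Summable b)
    (htail : ∀ k, b k ≤ ∑' n, b (n + (k + 1))) {s : ℝ} (hs : |s| ≤ ∑' n, b n) (n : ℕ) :
    |greedyRemainder b s n| ≤ ∑' i, b (i + n) := by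
  induction n with
  | zero => simpa [greedyRemainder] using hs
  | succ n ih =>
    refine abs_sub_signOrOne_mul_le (htail n) (ih.trans_eq ?_)
    rw [((summable_nat_add_iff n).2 hsum).tsum_eq_zero_add]
    simp only [zero_add, add_assoc, add_comm 1]

theorem stmt17 (b : ℕ → ℝ) (hb : ∀ n, 0 < b n) (hsum : Summable b)
    (htail : ∀ k, b k ≤ ∑' n : ℕ, b (k + 1 + n))
    (s : ℝ) (hs₁ : -∑' n, b n ≤ s) (hs₂ : s ≤ ∑' n, b n) :
    ∃ f : ℕ → ℝ, (∀ n, f n = -1 ∨ f n = 1) ∧ ∑' n, f n * b n = s := by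
  refine ⟨fun n => signOrOne (greedyRemainder b s n),
    fun n => signOrOne_eq_neg_one_or_one _, ?_⟩
  have hsummable : Summable fun n => signOrOne (greedyRemainder b s n) * b n := by
    refine Summable.of_norm_bounded hsum fun n => ?_
    rcases signOrOne_eq_neg_one_or_one (greedyRemainder b s n) with h | h <;>
      simp [h, abs_of_pos (hb n)]
  have hrem : Tendsto (greedyRemainder b s) atTop (nhds 0) :=
    squeeze_zero_norm
      (abs_greedyRemainder_le hsum
        (fun k => by simpa only [add_comm] using htail k) (abs_le.2 ⟨hs₁, hs₂⟩))
      (tendsto_sum_nat_add b)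
  refine tendsto_nhds_unique hsummable.hasSum.tendsto_sum_nat ?_
  simp only [sum_range_signOrOne_greedyRemainder]
  simpa using hrem.const_sub s
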